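/- Let K be a field, C a coalgebra over K, (φᵢ)_{i ∈ ι} a family of K-linear functionals on C, and (cᵢ)_{i ∈ ι} a family of scalars in K. Let S := {f ∈ C | R_{φᵢ}(f) = cᵢ • f for all i ∈ ι}, a K-linear subspace of C. Then Δ(S) ⊆ C ⊗ S; precisely, for every f ∈ S, the element Δ(f) of C ⊗[K] C lies in the image of the canonical injection C ⊗[K] S → C ⊗[K] C induced by the inclusion S ⊆ C. (This is the general fact underlying the paper's claim that the quantum homogeneous space function algebra E_q forms a left comodule under the comultiplication of the quantum group function algebra.) -/

import Mathlib

open TensorProduct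

/-- The right hit operator `R_φ = (id ⊗ φ) ∘ Δ`. -/
noncomputable def hitR {R C : Type*} [CommRing R] [AddCommGroup C] [Module R C]
    [Coalgebra R C] (φ : C →ₗ[R] R) : C →ₗ[R] C :=
  (TensorProduct.rid R C).toLinearMap ∘ₗ (TensorProduct.map LinearMap.id φ) ∘ₗ
    Coalgebra.comul

/-- The simultaneous eigenspace `S = {f | R_{φᵢ} f = cᵢ • f for all i}` of the right
hit operators. -/
noncomputable def simultaneousEigenspace {K C : Type*} [Field K] [AddCommGroup C]
    [Module K C] [Coalgebra K C] {ι : Type*} (φ : ι → (C →ₗ[K] K)) (c : ι → K) :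
    Submodule K C :=
  ⨅ i, LinearMap.ker (hitR (φ i) - c i • LinearMap.id)

/-- Tensoring a free module on the left commutes with intersections of kernels. -/
theorem TensorProduct.mem_range_lTensor_subtype_of_eq_iInf_ker {R M N P ι : Type*} [CommRing R]
    [AddCommGroup M] [Module R M] [Module.Free R M] [AddCommGroup N] [Module R N]
    [AddCommGroup P] [Module R P] (T : ι → N →ₗ[R] P) {S : Submodule R N}
    (hS : S = ⨅ i, LinearMap.ker (T i)) (z : M ⊗[R] N) (hz : ∀ i, (T i).lTensor M z = 0) :
    z ∈ LinearMap.range (S.subtype.lTensor M) := by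
  let b := Module.Free.chooseBasis R M
  have key (i) (k) (w : M ⊗[R] N) :
      equivFinsuppOfBasisLeft b ((T i).lTensor M w) k =
        T i (equivFinsuppOfBasisLeft b w k) := by
    induction w with
    | zero => simp
    | add x y hx hy => simp [hx, hy]
    | tmul x y => simp
  have hmem (k) : equivFinsuppOfBasisLeft b z k ∈ S := by
    simp [hS, Submodule.mem_iInf, ← key, hz]
  rw [← (equivFinsuppOfBasisLeft b).symm_apply_apply z, equivFinsuppOfBasisLeft_symm_apply]
  exact Submodule.sum_mem _ fun k _ ↦ ⟨b k ⊗ₜ ⟨_, hmem k⟩, rfl⟩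

/-- The comultiplication intertwines `R_φ` with `id ⊗ R_φ`. -/
theorem lTensor_hitR_comul {R C : Type*} [CommRing R] [AddCommGroup C] [Module R C]
    [Coalgebra R C] (φ : C →ₗ[R] R) (f : C) :
    (hitR φ).lTensor C (Coalgebra.comul (R := R) f) = Coalgebra.comul (R := R) (hitR φ f) := by
  let E : C ⊗[R] C →ₗ[R] C := (TensorProduct.rid R C).toLinearMap ∘ₗ φ.lTensor C
  have hE (z : C ⊗[R] C) (y : C) :
      E.lTensor C (TensorProduct.assoc R C C C (z ⊗ₜ y)) = φ y • z := by
    induction z with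
    | zero => simp
    | add u v hu hv => simp only [add_tmul, map_add, hu, hv, smul_add]
    | tmul u v => simp [E]
  have key (w : C ⊗[R] C) :
      E.lTensor C (TensorProduct.assoc R C C C ((Coalgebra.comul (R := R)).rTensor C w)) =
        Coalgebra.comul (R := R) (E w) := by
    induction w with
    | zero => simp
    | add u v hu hv => simp only [map_add, hu, hv]
    | tmul x y => rw [LinearMap.rTensor_tmul, hE]; simp [E]
  have h := key (Coalgebra.comul f)
  rw [Coalgebra.coassoc_apply, ← LinearMap.lTensor_comp_apply] at h
  exact h

/-- The simultaneous eigenspace `S` of the right hit operators is a left coideal: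
`Δ(S) ⊆ C ⊗ S`, i.e. for `f ∈ S`, `Δ(f)` lies in the image of the canonical injection
`C ⊗ S → C ⊗ C`. -/
theorem comul_mem_range_lTensor_subtype {K C : Type*} [Field K] [AddCommGroup C]
    [Module K C] [Coalgebra K C] {ι : Type*} (φ : ι → (C →ₗ[K] K)) (c : ι → K)
    (f : C) (hf : f ∈ simultaneousEigenspace φ c) :
    Coalgebra.comul (R := K) f ∈
      LinearMap.range (LinearMap.lTensor C (simultaneousEigenspace φ c).subtype) := by
  refine TensorProduct.mem_range_lTensor_subtype_of_eq_iInf_ker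
    (fun i ↦ hitR (φ i) - c i • LinearMap.id) rfl _ fun i ↦ ?_
  have hfi : hitR (φ i) f = c i • f := by
    simpa [sub_eq_zero] using (Submodule.mem_iInf _).mp hf i
  simp [LinearMap.lTensor_sub, LinearMap.lTensor_smul, lTensor_hitR_comul, hfi]
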